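/- arXiv:2105.00159 — 4 statements merged into one kernel-verified Lean document; each statement's English description precedes it below -/
import Mathlib

section
/- Let 𝒴 be a finite collection of mm-spaces and, for each Y ∈ 𝒴, let 𝒜_Y be a non-empty finite family of pairwise disjoint Borel subsets of Y with μ_Y(A) > 0 for every A ∈ 𝒜_Y; set U_Y := ⋃𝒜_Y. Then there exist a finite mm-space X (a finite metric space equipped with a probability measure) and, for each Y ∈ 𝒴, a 1-Lipschitz map f_Y : X → Y such that f_Y(X) ⊆ U_Y and (f_Y)_*μ_X(A) = μ_Y(A) / μ_Y(U_Y) for every A ∈ 𝒜_Y. -/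
open MeasureTheory

/-- Finitely many injective families `p i : J i → Y i` of points indexed by finite probability
spaces `(J i, ν i)` are simultaneously realised by `1`-Lipschitz maps from one finite
metric measure space: the product of the `J i`, with the supremum metric. -/
theorem exists_finite_mmSpace_map_eq {ι : Type*} [Finite ι]
    {Y : ι → Type*} [∀ i, MetricSpace (Y i)] [∀ i, MeasurableSpace (Y i)]
    {J : ι → Type*} [∀ i, Finite (J i)] [∀ i, MeasurableSpace (J i)]
    [∀ i, MeasurableSingletonClass (J i)]
    (ν : ∀ i, Measure (J i)) [∀ i, IsProbabilityMeasure (ν i)]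
    (p : ∀ i, J i → Y i) (hp : ∀ i, Function.Injective (p i)) :
    ∃ (X : Type) (_ : MetricSpace X) (_ : Fintype X)
      (_ : MeasurableSpace X) (_ : BorelSpace X) (μX : Measure X),
      IsProbabilityMeasure μX ∧
      ∀ i, ∃ f : X → Y i, Measurable f ∧ LipschitzWith 1 f ∧
        Set.range f ⊆ Set.range (p i) ∧ μX.map f = (ν i).map (p i) := by
  cases nonempty_fintype ι
  obtain ⟨X, hX, ⟨e⟩⟩ : ∃ (X : Type) (_ : Fintype X), Nonempty (X ≃ ∀ i, J i) :=
    ⟨Fin (Nat.card (∀ i, J i)), inferInstance, ⟨(Finite.equivFin _).symm⟩⟩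
  have hg : Function.Injective fun x i => p i (e x i) := fun x y hxy =>
    e.injective (funext fun i => hp i (congrFun hxy i))
  let : MetricSpace X := MetricSpace.induced _ hg inferInstance
  let : MeasurableSpace X := borel X
  have : BorelSpace X := ⟨rfl⟩
  have he : Measurable e.symm := .of_discrete
  refine ⟨X, inferInstance, hX, inferInstance, inferInstance, (Measure.pi ν).map e.symm,
    Measure.isProbabilityMeasure_map he.aemeasurable, fun i => ?_⟩
  refine ⟨fun x => p i (e x i), .of_discrete, ?_, ?_, ?_⟩
  · exact LipschitzWith.of_dist_le_mul fun x y => by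
      rw [NNReal.coe_one, one_mul]
      exact dist_le_pi_dist (fun j => p j (e x j)) (fun j => p j (e y j)) i
  · rintro _ ⟨x, rfl⟩
    exact ⟨_, rfl⟩
  · rw [Measure.map_map .of_discrete he,
      ← (measurePreserving_eval ν i).map_eq, Measure.map_map .of_discrete (measurable_pi_apply i)]
    congr 1
    ext x
    simp

/-- Given a finite collection of mm-spaces `Y i`, each with a nonempty
finite family `𝒜 i` of pairwise disjoint Borel sets of positive measure with union
`U_i = ⋃₀ 𝒜 i`, there exist a finite mm-space `X` and `1`-Lipschitz (Borel) maps
`f_i : X → Y i` with `f_i(X) ⊆ U_i` and `(f_i)_* μX (A) = μ_i(A) / μ_i(U_i)` for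
every `A ∈ 𝒜 i`. -/
theorem stmt1 {ι : Type*} [Finite ι]
    (Y : ι → Type*) [∀ i, MetricSpace (Y i)] [∀ i, CompleteSpace (Y i)]
    [∀ i, TopologicalSpace.SeparableSpace (Y i)]
    [∀ i, MeasurableSpace (Y i)] [∀ i, BorelSpace (Y i)]
    (μ : ∀ i, Measure (Y i)) [∀ i, IsProbabilityMeasure (μ i)]
    (𝒜 : ∀ i, Set (Set (Y i)))
    (hfin : ∀ i, (𝒜 i).Finite) (hne : ∀ i, (𝒜 i).Nonempty)
    (hdisj : ∀ i, (𝒜 i).PairwiseDisjoint id)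
    (hmeas : ∀ i, ∀ A ∈ 𝒜 i, MeasurableSet A)
    (hpos : ∀ i, ∀ A ∈ 𝒜 i, 0 < μ i A) :
    ∃ (X : Type) (_ : MetricSpace X) (_ : Fintype X)
      (_ : MeasurableSpace X) (_ : BorelSpace X) (μX : Measure X),
      IsProbabilityMeasure μX ∧
      ∀ i, ∃ f : X → Y i, Measurable f ∧ LipschitzWith 1 f ∧
        Set.range f ⊆ ⋃₀ 𝒜 i ∧
        ∀ A ∈ 𝒜 i, (μX.map f) A = μ i A / μ i (⋃₀ 𝒜 i) := by
  choose p hp using fun (i : ι) (A : 𝒜 i) => nonempty_of_measure_ne_zero (hpos i A A.2).ne'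
  let : ∀ i, MeasurableSpace (𝒜 i) := fun _ => ⊤
  have : ∀ i, Finite (𝒜 i) := fun i => (hfin i).to_subtype
  have hU : ∀ i, μ i (⋃₀ 𝒜 i) ≠ 0 := fun i => by
    obtain ⟨A, hA⟩ := hne i
    exact ((hpos i A hA).trans_le (measure_mono (Set.subset_sUnion_of_mem hA))).ne'
  have hmem : ∀ i (A B : 𝒜 i), p i A ∈ (B : Set (Y i)) → A = B := fun i A B h => by
    by_contra hAB
    exact Set.disjoint_left.1 (hdisj i A.2 B.2 (Subtype.coe_injective.ne hAB)) (hp i A) h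
  let ν : ∀ i, Measure (𝒜 i) := fun i =>
    Measure.sum fun A : 𝒜 i => (μ i A / μ i (⋃₀ 𝒜 i)) • Measure.dirac A
  have : ∀ i, IsProbabilityMeasure (ν i) := fun i => ⟨by
    have hsum : μ i (⋃₀ 𝒜 i) = ∑' A : 𝒜 i, μ i A :=
      measure_sUnion (hfin i).countable (hdisj i) (hmeas i)
    simp only [ν, Measure.sum_apply _ MeasurableSet.univ, Measure.smul_apply, measure_univ,
      smul_eq_mul, mul_one, div_eq_mul_inv]
    rw [ENNReal.tsum_mul_right, ← hsum]
    exact ENNReal.mul_inv_cancel (hU i) (measure_ne_top _ _)⟩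
  obtain ⟨X, mX, fX, msX, bX, μX, hμX, hf⟩ := exists_finite_mmSpace_map_eq ν p
    fun i A B hAB => hmem i A B (hAB ▸ hp i B)
  refine ⟨X, mX, fX, msX, bX, μX, hμX, fun i => ?_⟩
  obtain ⟨f, hfm, hfl, hfr, hfe⟩ := hf i
  refine ⟨f, hfm, hfl, hfr.trans ?_, fun A hA => ?_⟩
  · rintro _ ⟨A, rfl⟩
    exact ⟨A, A.2, hp i A⟩
  · have hpre : p i ⁻¹' A = {⟨A, hA⟩} := by
      ext B
      refine ⟨hmem i B ⟨A, hA⟩, ?_⟩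
      rintro rfl
      exact hp i ⟨A, hA⟩
    rw [hfe, Measure.map_apply .of_discrete (hmeas i A hA), hpre,
      Measure.sum_apply _ (measurableSet_singleton _), tsum_eq_single ⟨A, hA⟩]
    · simp
    · intro B hB
      simp [hB]
end

section
/- Let X be a finite mm-space, 𝒴 a finite collection of mm-spaces, and ε, ε' > 0 with ε < 1. Suppose that for each Y ∈ 𝒴 there are a map g_Y : X → Y and a non-empty finite family 𝒜_Y of pairwise disjoint Borel subsets of Y such that, with U_Y := ⋃𝒜_Y: (1) g_Y(X) ⊆ U_Y; (2) d_Y(g_Y(x), g_Y(x')) ≤ d_X(x, x') + ε' for all x, x' ∈ X; (3) μ_Y(A) > 0 and (g_Y)_*μ_X(A) ≤ (1+ε) μ_Y(A) for every A ∈ 𝒜_Y. Then there exist a finite mm-space X' and an isometric embedding ι : X → X' with ι_*μ_X(B) ≤ μ_{X'}(B) + ε for every Borel set B ⊆ X' (hence the Prohorov distance between ι_*μ_X and μ_{X'} is at most ε), together with, for each Y ∈ 𝒴, a map f_Y : X' → Y satisfying: (4) f_Y(X') ⊆ U_Y; (5) d_Y(f_Y(x), f_Y(x')) ≤ d_{X'}(x,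 x') + ε' for all x, x' ∈ X'; (6) (f_Y)_*μ_{X'}(A) = μ_Y(A)/μ_Y(U_Y) for every A ∈ 𝒜_Y. -/
open MeasureTheory

/-- The metric on `X ⊕ P` in which every point of `P` is at distance `R` from every other point. -/
noncomputable abbrev sumConstMetric {X P : Type*} [MetricSpace X] (R : ℝ) (hR : 0 < R)
    (hX : ∀ x y : X, dist x y ≤ R) : MetricSpace (X ⊕ P) := by
  classical
  exact
  { dist := fun u v => match u, v with
      | .inl x, .inl y => dist x y
      | .inr p, .inr q => if p = q then 0 else R
      | _, _ => R
    dist_self := by rintro (x | p) <;> simp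
    dist_comm := by
      rintro (x | p) (y | q)
      · exact dist_comm x y
      · rfl
      · rfl
      · simp only [eq_comm]
    dist_triangle := by
      rintro (x | p) (y | q) (z | r)
      · exact dist_triangle x y z
      · exact le_add_of_nonneg_left dist_nonneg
      · exact (hX x z).trans (by linarith)
      · dsimp only
        split_ifs <;> linarith
      · exact le_add_of_nonneg_right dist_nonneg
      · dsimp only
        split_ifs <;> linarith
      · dsimp only
        split_ifs <;> linarith
      · dsimp only
        split_ifs with h₁ h₂ h₃ h₃ h₂ h₃ h₃ <;> first | linarith | (subst_vars; contradiction)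
    eq_of_dist_eq_zero := by
      rintro (x | p) (y | q) h
      · exact congrArg _ (eq_of_dist_eq_zero h)
      · exact absurd h hR.ne'
      · exact absurd h hR.ne'
      · by_contra hne
        have hpq : p ≠ q := fun h' => hne (congrArg _ h')
        exact hR.ne' ((if_neg hpq).symm.trans h) }

/-- A finite metric space can be enlarged by finitely many points, arbitrarily far from
every other point. -/
theorem exists_isometric_extension {X P : Type*} [MetricSpace X] [Finite X] [Finite P] (R : ℝ) :
    ∃ (X' : Type) (_ : MetricSpace X') (_ : Fintype X') (e : X ⊕ P ≃ X'),
      Isometry (e ∘ Sum.inl) ∧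
      ∀ p z, e (Sum.inr p) ≠ z → R ≤ dist (e (Sum.inr p)) z := by
  obtain ⟨D, hD⟩ := (Set.finite_range fun q : X × X => dist q.1 q.2).bddAbove
  have hX : ∀ x y : X, dist x y ≤ max (max R D) 1 := fun x y =>
    (hD ⟨(x, y), rfl⟩).trans ((le_max_right R D).trans (le_max_left _ _))
  let := sumConstMetric (P := P) (max (max R D) 1) (zero_lt_one.trans_le (le_max_right _ _)) hX
  obtain ⟨n, ⟨e⟩⟩ := Finite.exists_equiv_fin (X ⊕ P)
  let := MetricSpace.induced e.symm e.symm.injective inferInstance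
  have he : ∀ u v, dist (e u) (e v) = dist u v := fun u v => by
    change dist (e.symm (e u)) (e.symm (e v)) = _
    simp
  refine ⟨Fin n, inferInstance, inferInstance, e, ?_, fun p z hz => ?_⟩
  · exact Isometry.of_dist_eq fun x y => he _ _
  · obtain ⟨v, rfl⟩ := e.surjective z
    rw [he]
    refine ((le_max_left R D).trans (le_max_left _ 1)).trans (le_of_eq ?_)
    rcases v with x | q
    · rfl
    · have hpq : p ≠ q := fun h => hz (by rw [h])
      exact (if_neg hpq).symm

open scoped ENNReal in
/-- If `c • lam` is dominated by `μ` on each member of a finite partition of a carrier of `lam`,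
some probability measure on the index set complements `c • lam` to the conditional measure
of `μ` on the union. -/
theorem exists_complementary_measure {α Y : Type*} [Fintype α] [MeasurableSpace α]
    [MeasurableSingletonClass α] [MeasurableSpace Y] (lam μ : Measure Y)
    [IsProbabilityMeasure μ] (A : α → Set Y)
    (hdisj : Pairwise (Function.onFun Disjoint A)) (hmeas : ∀ a, MeasurableSet (A a))
    (hlam : lam (⋃ a, A a) = 1) (hpos : ∀ a, 0 < μ (A a)) {c s : ℝ≥0∞} (hcs : c + s = 1)
    (hs : s ≠ 0) (hle : ∀ a, c * lam (A a) ≤ μ (A a)) :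
    ∃ ν : Measure α, IsProbabilityMeasure ν ∧
      ∀ a, c * lam (A a) + s * ν {a} = μ (A a) / μ (⋃ a, A a) := by
  have hc_top : c ≠ ∞ := fun h => by simp [h] at hcs
  have hs_top : s ≠ ∞ := fun h => by simp [h] at hcs
  have hU : μ (⋃ a, A a) ≠ 0 := by
    rcases isEmpty_or_nonempty α with h | ⟨⟨a⟩⟩
    · simp at hlam
    · exact ((hpos a).trans_le (measure_mono (Set.subset_iUnion A a))).ne'
  have hle' : ∀ a, c * lam (A a) ≤ μ (A a) / μ (⋃ a, A a) := fun a =>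
    (hle a).trans (by
      simpa using ENNReal.div_le_div_left (prob_le_one (μ := μ) (s := ⋃ a, A a)) (μ (A a)))
  set r : α → ℝ≥0∞ := fun a => μ (A a) / μ (⋃ a, A a) - c * lam (A a)
  have hr_add : ∀ a, c * lam (A a) + r a = μ (A a) / μ (⋃ a, A a) := fun a =>
    add_tsub_cancel_of_le (hle' a)
  have hsum : ∑ a, r a = s := by
    have h : ∑ a, (c * lam (A a) + r a) = 1 := by
      simp_rw [hr_add, div_eq_mul_inv]
      rw [← Finset.sum_mul, ← tsum_fintype (L := .unconditional α), ← measure_iUnion hdisj hmeas]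
      exact ENNReal.mul_inv_cancel hU (measure_ne_top _ _)
    rw [Finset.sum_add_distrib, ← Finset.mul_sum, ← tsum_fintype (L := .unconditional α),
      ← measure_iUnion hdisj hmeas, hlam, mul_one, ← hcs] at h
    exact (ENNReal.add_right_inj hc_top).1 h
  refine ⟨Measure.sum fun a => (s⁻¹ * r a) • Measure.dirac a,
    HasSum.isProbabilityMeasure_sum_dirac_ennreal ?_, fun a => ?_⟩
  · have h : ∑ a, s⁻¹ * r a = 1 := by
      rw [← Finset.mul_sum, hsum, ENNReal.inv_mul_cancel hs hs_top]
    exact h ▸ hasSum_fintype _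
  · rw [Measure.sum_smul_dirac_singleton, ← mul_assoc, ENNReal.mul_inv_cancel hs hs_top, one_mul,
      hr_add]

/-- A one-sided setwise bound controls the Lévy–Prokhorov distance of probability measures. -/
theorem levyProkhorovDist_le_of_forall_measure_le {Ω : Type*} [PseudoMetricSpace Ω]
    [MeasurableSpace Ω] [OpensMeasurableSpace Ω] (μ ν : Measure Ω)
    [IsProbabilityMeasure μ] [IsProbabilityMeasure ν] {δ : ℝ} (hδ : 0 ≤ δ) (h : ∀ B, MeasurableSet B → μ B ≤ ν B + ENNReal.ofReal δ) :
    levyProkhorovDist μ ν ≤ δ :=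
  levyProkhorovDist_le_of_forall_le μ ν hδ fun _ B hlt hB =>
    (h B hB).trans (add_le_add
      (measure_mono (Metric.self_subset_thickening (hδ.trans_lt hlt) B))
      (ENNReal.ofReal_le_ofReal hlt.le))

/-- Given a finite mm-space `X`, a finite family of mm-spaces `Y i` with
maps `g i : X → Y i` and families `𝒜 i` satisfying conditions (1)–(3), with
`0 < ε < 1` and `0 < ε'`, there exist a finite mm-space `X'` and an isometric
embedding `ι : X → X'` with `ι_* μX (B) ≤ μ' B + ε` for all Borel `B` (hence
`d_P(ι_* μX, μ') ≤ ε`), together with maps `f i : X' → Y i` satisfying (4)–(6). -/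
theorem stmt3 {ι : Type*} [Finite ι]
    {X : Type*} [MetricSpace X] [Fintype X] [MeasurableSpace X] [BorelSpace X]
    (μX : Measure X) [IsProbabilityMeasure μX]
    (Y : ι → Type*) [∀ i, MetricSpace (Y i)] [∀ i, CompleteSpace (Y i)]
    [∀ i, TopologicalSpace.SeparableSpace (Y i)]
    [∀ i, MeasurableSpace (Y i)] [∀ i, BorelSpace (Y i)]
    (μ : ∀ i, Measure (Y i)) [∀ i, IsProbabilityMeasure (μ i)]
    (ε ε' : ℝ) (hε : 0 < ε) (hε1 : ε < 1) (hε' : 0 < ε')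
    (g : ∀ i, X → Y i) (hgmeas : ∀ i, Measurable (g i))
    (𝒜 : ∀ i, Set (Set (Y i)))
    (h𝒜fin : ∀ i, (𝒜 i).Finite) (h𝒜ne : ∀ i, (𝒜 i).Nonempty)
    (h𝒜disj : ∀ i, (𝒜 i).PairwiseDisjoint id)
    (h𝒜meas : ∀ i, ∀ A ∈ 𝒜 i, MeasurableSet A)
    (h1 : ∀ i, Set.range (g i) ⊆ ⋃₀ 𝒜 i)
    (h2 : ∀ i, ∀ x x' : X, dist (g i x) (g i x') ≤ dist x x' + ε')
    (h3 : ∀ i, ∀ A ∈ 𝒜 i, 0 < μ i A ∧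
      (μX.map (g i)) A ≤ ENNReal.ofReal (1 + ε) * μ i A) :
    ∃ (X' : Type) (_ : MetricSpace X') (_ : Fintype X')
      (_ : MeasurableSpace X') (_ : BorelSpace X') (μ' : Measure X'),
      IsProbabilityMeasure μ' ∧
      ∃ j : X → X', Isometry j ∧ Measurable j ∧
        (∀ B : Set X', MeasurableSet B →
          (μX.map j) B ≤ μ' B + ENNReal.ofReal ε) ∧
        levyProkhorovDist (μX.map j) μ' ≤ ε ∧
        ∀ i, ∃ f : X' → Y i, Measurable f ∧
          Set.range f ⊆ ⋃₀ 𝒜 i ∧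
          (∀ x x' : X', dist (f x) (f x') ≤ dist x x' + ε') ∧
          ∀ A ∈ 𝒜 i, (μ'.map f) A = μ i A / μ i (⋃₀ 𝒜 i) := by
  have := Fintype.ofFinite ι
  set c := ENNReal.ofReal (1 / (1 + ε)) with hc
  set s := ENNReal.ofReal (ε / (1 + ε)) with hs
  have hcs : c + s = 1 := by
    rw [hc, hs, ← ENNReal.ofReal_add (by positivity) (by positivity), ← add_div,
      div_self (by positivity), ENNReal.ofReal_one]
  have hs0 : s ≠ 0 := by
    rw [hs, Ne, ENNReal.ofReal_eq_zero, not_le]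
    positivity
  have hcε : c * ENNReal.ofReal (1 + ε) = 1 := by
    rw [hc, ← ENNReal.ofReal_mul (by positivity), one_div_mul_cancel (by positivity),
      ENNReal.ofReal_one]
  have hsε : s ≤ ENNReal.ofReal ε :=
    ENNReal.ofReal_le_ofReal (div_le_self hε.le (by linarith))
  choose n A hAinj hArange using fun i => (h𝒜fin i).fin_param
  have hA : ∀ i a, A i a ∈ 𝒜 i := fun i a => hArange i ▸ Set.mem_range_self a
  have hAU : ∀ i, ⋃ a, A i a = ⋃₀ 𝒜 i := fun i => by rw [← hArange i, Set.sUnion_range]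
  have hAdisj : ∀ i, Pairwise (Function.onFun Disjoint (A i)) := fun i a b hab =>
    h𝒜disj i (hA i a) (hA i b) ((hAinj i).ne hab)
  have hν : ∀ i, ∃ ν : Measure (Fin (n i)), IsProbabilityMeasure ν ∧
      ∀ a, c * μX.map (g i) (A i a) + s * ν {a} = μ i (A i a) / μ i (⋃ a, A i a) := by
    intro i
    refine exists_complementary_measure _ (μ i) (A i) (hAdisj i)
      (fun a => h𝒜meas i _ (hA i a)) ?_ (fun a => (h3 i _ (hA i a)).1) hcs hs0 fun a => ?_
    · rw [hAU, Measure.map_apply (hgmeas i)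
        (MeasurableSet.sUnion (h𝒜fin i).countable (h𝒜meas i)),
        Set.preimage_eq_univ_iff.2 (h1 i), measure_univ]
    · calc c * μX.map (g i) (A i a) ≤ c * (ENNReal.ofReal (1 + ε) * μ i (A i a)) := by
            gcongr
            exact (h3 i _ (hA i a)).2
        _ = μ i (A i a) := by rw [← mul_assoc, hcε, one_mul]
  choose ν hνprob hνeq using hν
  choose y hy using fun i a => nonempty_of_measure_ne_zero (h3 i _ (hA i a)).1.ne'
  let F : ∀ i, X ⊕ (∀ i, Fin (n i)) → Y i := fun i => Sum.elim (g i) fun p => y i (p i)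
  obtain ⟨R, hR⟩ := (Set.finite_range fun q : ι × (X ⊕ (∀ i, Fin (n i))) ×
    (X ⊕ (∀ i, Fin (n i))) => dist (F q.1 q.2.1) (F q.1 q.2.2)).bddAbove
  have hFR : ∀ i u v, dist (F i u) (F i v) ≤ R := fun i u v => hR ⟨(i, u, v), rfl⟩
  obtain ⟨X', _, _, e, he, heR⟩ :=
    exists_isometric_extension (X := X) (P := ∀ i, Fin (n i)) R
  let : MeasurableSpace X' := borel X'
  have : BorelSpace X' := ⟨rfl⟩
  have hj : Measurable (e ∘ Sum.inl : X → X') := measurable_of_finite _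
  have hk : Measurable (e ∘ Sum.inr : (∀ i, Fin (n i)) → X') := measurable_of_finite _
  have := Measure.isProbabilityMeasure_map (μ := μX) hj.aemeasurable
  have := Measure.isProbabilityMeasure_map (μ := Measure.pi ν) hk.aemeasurable
  let μ' : Measure X' := c • μX.map (e ∘ Sum.inl) + s • (Measure.pi ν).map (e ∘ Sum.inr)
  have hμ' : IsProbabilityMeasure μ' := ⟨by simp [μ', hcs]⟩
  have hB : ∀ B : Set X', MeasurableSet B →
      μX.map (e ∘ Sum.inl) B ≤ μ' B + ENNReal.ofReal ε := fun B _ =>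
    calc μX.map (e ∘ Sum.inl) B
        = c * μX.map (e ∘ Sum.inl) B + s * μX.map (e ∘ Sum.inl) B := by
          rw [← add_mul, hcs, one_mul]
      _ ≤ μ' B + ENNReal.ofReal ε :=
          add_le_add (by simp [μ']) ((mul_le_of_le_one_right' prob_le_one).trans hsε)
  refine ⟨X', inferInstance, inferInstance, inferInstance, inferInstance, μ', hμ',
    e ∘ Sum.inl, he, hj, hB, levyProkhorovDist_le_of_forall_measure_le _ _ hε.le hB,
    fun i => ?_⟩
  have hf : Measurable (F i ∘ e.symm) := measurable_of_finite _
  refine ⟨F i ∘ e.symm, hf, ?_, fun z z' => ?_, fun B hBmem => ?_⟩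
  · rintro _ ⟨z, rfl⟩
    obtain ⟨x | p, rfl⟩ := e.surjective z
    · simpa [F] using h1 i (Set.mem_range_self x)
    · simpa [F] using ⟨_, hA i (p i), hy i (p i)⟩
  · by_cases hzz : z = z'
    · simp [hzz, hε'.le]
    obtain ⟨x | p, rfl⟩ := e.surjective z
    · obtain ⟨x' | p', rfl⟩ := e.surjective z'
      · simpa [F, ← he.dist_eq x x'] using h2 i x x'
      · have := heR p' _ (Ne.symm hzz)
        rw [dist_comm] at this
        exact (hFR i _ _).trans (this.trans (by linarith))
    · exact (hFR i _ _).trans ((heR p z' hzz).trans (by linarith))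
  · obtain ⟨a, rfl⟩ : B ∈ Set.range (A i) := hArange i ▸ hBmem
    have hmeas := h𝒜meas i _ (hA i a)
    have hgi : F i ∘ e.symm ∘ e ∘ Sum.inl = g i := by ext; simp [F]
    have hyi : (F i ∘ e.symm ∘ e ∘ Sum.inr) ⁻¹' A i a =
        (Function.eval i : (∀ i, Fin (n i)) → Fin (n i)) ⁻¹' {a} := by
      ext p
      simp only [Set.mem_preimage, Function.comp_apply, Equiv.symm_apply_apply, F, Sum.elim_inr,
        Function.eval, Set.mem_singleton_iff]
      refine ⟨fun h => ?_, fun h => h ▸ hy i (p i)⟩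
      by_contra hne
      exact Set.disjoint_left.1 (hAdisj i hne) (hy i (p i)) h
    rw [Measure.map_add _ _ hf, Measure.map_smul, Measure.map_smul, Measure.map_map hf hj,
      Measure.map_map hf hk, Measure.add_apply, Measure.smul_apply, Measure.smul_apply,
      smul_eq_mul, smul_eq_mul, Function.comp_assoc, Function.comp_assoc, hgi,
      Measure.map_apply (measurable_of_finite _) hmeas (μ := Measure.pi ν), hyi,
      (measurePreserving_eval ν i).measure_preimage (measurableSet_singleton a).nullMeasurableSet,
      hνeq, hAU]
end

section
/- If a family 𝒴 of nonempty compact metric spaces is precompact with respect to the Gromov–Hausdorff distance, then there exists a nonempty compact metric space X such that for every Y ∈ 𝒴 there is a 1-Lipschitz surjection f : X → Y. -/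
open GromovHausdorff

namespace GromovHausdorff

/-- Compact metric spaces at Gromov–Hausdorff distance less than `ε` are related by an
approximate isometry. -/
theorem exists_approx_map_of_ghDist_lt {A B : Type*} [MetricSpace A] [CompactSpace A] [Nonempty A]
    [MetricSpace B] [CompactSpace B] [Nonempty B] {ε : ℝ} (h : ghDist A B < ε) :
    ∃ φ : A → B, (∀ x x', dist (φ x) (φ x') ≤ dist x x' + 2 * ε) ∧
      ∀ y, ∃ x, dist (φ x) y ≤ 2 * ε := by
  obtain ⟨Φ, Ψ, hΦ, hΨ, hd⟩ := ghDist_eq_hausdorffDist A B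
  rw [hd] at h
  have hfin : Metric.hausdorffEDist (Set.range Φ) (Set.range Ψ) ≠ ⊤ :=
    Metric.hausdorffEDist_ne_top_of_nonempty_of_bounded (Set.range_nonempty _)
      (Set.range_nonempty _) (isCompact_range hΦ.continuous).isBounded
      (isCompact_range hΨ.continuous).isBounded
  have hl : ∀ x, ∃ y, dist (Φ x) (Ψ y) < ε := fun x => by
    obtain ⟨_, ⟨y, rfl⟩, hy⟩ :=
      Metric.exists_dist_lt_of_hausdorffDist_lt (Set.mem_range_self x) h hfin
    exact ⟨y, hy⟩
  choose φ hφ using hl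
  refine ⟨φ, fun x x' => ?_, fun y => ?_⟩
  · rw [← hΨ.dist_eq, ← hΦ.dist_eq x x']
    have h₁ := dist_triangle4 (Ψ (φ x)) (Φ x) (Φ x') (Ψ (φ x'))
    have h₂ := hφ x
    have h₃ := hφ x'
    rw [dist_comm] at h₂
    linarith
  · obtain ⟨_, ⟨x, rfl⟩, hx⟩ :=
      Metric.exists_dist_lt_of_hausdorffDist_lt' (Set.mem_range_self y) h hfin
    refine ⟨x, ?_⟩
    rw [← hΨ.dist_eq]
    have h₁ := dist_triangle_left (Ψ (φ x)) (Ψ y) (Φ x)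
    have h₂ := hφ x
    linarith

section UniformBounds

variable {ι : Type*} {Y : ι → Type*} [∀ i, MetricSpace (Y i)]
    [∀ i, CompactSpace (Y i)] [∀ i, Nonempty (Y i)]

theorem exists_dist_le_of_totallyBounded
    (h : TotallyBounded (Set.range fun i => toGHSpace (Y i))) :
    ∃ D : ℝ, ∀ i (y y' : Y i), dist y y' ≤ D := by
  obtain ⟨t, ht, hcov⟩ := Metric.totallyBounded_iff.1 h 1 one_pos
  obtain ⟨D, hD⟩ := (ht.image fun p : GHSpace => Metric.diam (Set.univ : Set p.Rep)).bddAbove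
  refine ⟨D + 6, fun i y y' => ?_⟩
  obtain ⟨p, hp, hip⟩ := Set.mem_iUnion₂.1 (hcov (Set.mem_range_self i))
  rw [Metric.mem_ball', ← p.toGHSpace_rep] at hip
  obtain ⟨φ, hφ, hs⟩ := exists_approx_map_of_ghDist_lt hip
  obtain ⟨x, hx⟩ := hs y
  obtain ⟨x', hx'⟩ := hs y'
  have h₁ := hD (Set.mem_image_of_mem _ hp)
  have h₂ := Metric.dist_le_diam_of_mem (isCompact_univ (X := p.Rep)).isBounded
    (Set.mem_univ x) (Set.mem_univ x')
  have h₃ := hφ x x'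
  have h₄ := dist_triangle4 y (φ x) (φ x') y'
  rw [dist_comm y (φ x)] at h₄
  linarith

theorem exists_nets_of_totallyBounded
    (h : TotallyBounded (Set.range fun i => toGHSpace (Y i))) {ε : ℝ} (hε : 0 < ε) :
    ∃ N : ℕ, ∀ i, ∃ c : Fin (N + 1) → Y i, ∀ y, ∃ j, dist (c j) y ≤ ε := by
  obtain ⟨t, ht, hcov⟩ := Metric.totallyBounded_iff.1 h (ε / 5) (by positivity)
  have hnet : ∀ p : GHSpace, ∃ s : Finset p.Rep, ∀ x, ∃ z ∈ s, dist x z < ε / 5 := fun p => by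
    obtain ⟨s, -, hs, hsc⟩ :=
      (isCompact_univ (X := p.Rep)).finite_cover_balls (show 0 < ε / 5 by positivity)
    refine ⟨hs.toFinset, fun x => ?_⟩
    obtain ⟨z, hz, hxz⟩ := Set.mem_iUnion₂.1 (hsc (Set.mem_univ x))
    exact ⟨z, hs.mem_toFinset.2 hz, hxz⟩
  choose s hs using hnet
  obtain ⟨N, hN⟩ := (ht.image fun p => (s p).card).bddAbove
  refine ⟨N, fun i => ?_⟩
  obtain ⟨p, hp, hip⟩ := Set.mem_iUnion₂.1 (hcov (Set.mem_range_self i))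
  rw [Metric.mem_ball', ← p.toGHSpace_rep] at hip
  obtain ⟨φ, hφ, hsurj⟩ := exists_approx_map_of_ghDist_lt hip
  have hcard : (s p).card ≤ N := hN (Set.mem_image_of_mem _ hp)
  let e := (s p).equivFin
  refine ⟨fun j => if hj : j.1 < (s p).card then φ (e.symm ⟨j, hj⟩) else Classical.arbitrary _,
    fun y => ?_⟩
  obtain ⟨x, hx⟩ := hsurj y
  obtain ⟨z, hz, hxz⟩ := hs p x
  refine ⟨⟨e ⟨z, hz⟩, by have := (e ⟨z, hz⟩).2; omega⟩, ?_⟩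
  simp only [Fin.is_lt, dite_true, Fin.eta, Equiv.symm_apply_apply]
  have h₁ := dist_triangle (φ z) (φ x) y
  have h₂ := hφ z x
  rw [dist_comm z] at h₂
  linarith

end UniformBounds

end GromovHausdorff

section NetWalk

variable {Y : Type*} [MetricSpace Y] {E : ℕ → Type*} (c : ∀ n, E n → Y)

open Classical in
/-- The walk which, at each step, moves to the next prescribed point if that point is
close enough, and otherwise stays where it is. -/
noncomputable def netWalk (x : ∀ n, E n) : ℕ → Y
  | 0 => c 0 (x 0)
  | n + 1 => if dist (netWalk x n) (c (n + 1) (x (n + 1))) ≤ 2 * (1 / 2) ^ n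
      then c (n + 1) (x (n + 1)) else netWalk x n

theorem dist_netWalk_succ_le (x : ∀ n, E n) (n : ℕ) :
    dist (netWalk c x n) (netWalk c x (n + 1)) ≤ 2 * (1 / 2) ^ n := by
  rw [netWalk]
  split_ifs with h
  · exact h
  · rw [dist_self]; positivity

theorem netWalk_congr {x x' : ∀ n, E n} {n : ℕ} (h : ∀ k ≤ n, x k = x' k) :
    netWalk c x n = netWalk c x' n := by
  induction n with
  | zero => simp [netWalk, h 0 le_rfl]
  | succ n ih => simp only [netWalk, h (n + 1) le_rfl, ih fun k hk => h k (hk.trans n.le_succ)]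

theorem netWalk_eq {x : ∀ n, E n} {y : Y} (h : ∀ n, dist (c n (x n)) y ≤ (1 / 2) ^ n) (n : ℕ) :
    netWalk c x n = c n (x n) := by
  induction n with
  | zero => rfl
  | succ n ih =>
    rw [netWalk, ih, if_pos]
    have h₁ := dist_triangle_right (c n (x n)) (c (n + 1) (x (n + 1))) y
    have h₂ := h n
    have h₃ := h (n + 1)
    rw [pow_succ] at h₃
    have h₄ : (0 : ℝ) < (1 / 2) ^ n := by positivity
    linarith

attribute [local instance] PiNat.dist

theorem exists_surjective_dist_le_piNat [CompleteSpace Y] {D : ℝ}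
    (hD : ∀ y y' : Y, dist y y' ≤ D) (hc : ∀ n y, ∃ j, dist (c n j) y ≤ (1 / 2) ^ n) :
    ∃ f : (∀ n, E n) → Y, Function.Surjective f ∧
      ∀ x x', dist (f x) (f x') ≤ max D 16 * dist x x' := by
  have hlim : ∀ x, ∃ y, Filter.Tendsto (netWalk c x) Filter.atTop (nhds y) := fun x =>
    cauchySeq_tendsto_of_complete
      (cauchySeq_of_le_geometric _ _ (by norm_num) (dist_netWalk_succ_le c x))
  choose f hf using hlim
  refine ⟨f, fun y => ?_, fun x x' => ?_⟩
  · choose x hx using fun n => hc n y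
    refine ⟨x, tendsto_nhds_unique (hf x) ?_⟩
    rw [tendsto_iff_dist_tendsto_zero]
    refine squeeze_zero (fun _ => dist_nonneg) (fun n => ?_)
      (tendsto_pow_atTop_nhds_zero_of_lt_one (r := (1 / 2 : ℝ)) (by norm_num) (by norm_num))
    rw [netWalk_eq c hx]
    exact hx n
  · rcases eq_or_ne x x' with rfl | hne
    · simp [PiNat.dist_self]
    rw [PiNat.dist_eq_of_ne hne]
    rcases hn : PiNat.firstDiff x x' with _ | n
    · simpa using Or.inl (hD _ _)
    · have heq : netWalk c x n = netWalk c x' n :=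
        netWalk_congr c fun k hk => PiNat.apply_eq_of_lt_firstDiff (by omega)
      have h₁ := dist_le_of_le_geometric_of_tendsto _ _ (by norm_num)
        (dist_netWalk_succ_le c x) (hf x) n
      have h₂ := dist_le_of_le_geometric_of_tendsto _ _ (by norm_num)
        (dist_netWalk_succ_le c x') (hf x') n
      rw [← heq] at h₂
      rw [show (1 - 1 / 2 : ℝ) = 1 / 2 by norm_num] at h₁ h₂
      have h₃ := dist_triangle_left (f x) (f x') (netWalk c x n)
      calc dist (f x) (f x') ≤ 16 * (1 / 2) ^ (n + 1) := by rw [pow_succ]; linarith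
        _ ≤ _ := by gcongr; exact le_max_right _ _

end NetWalk

/-- A compact metric space can be rescaled by any positive factor. -/
theorem exists_compact_rescaling (X : Type) [MetricSpace X] [CompactSpace X] [Nonempty X]
    {C : ℝ} (hC : 0 < C) :
    ∃ (Z : Type) (_ : MetricSpace Z) (_ : CompactSpace Z) (_ : Nonempty Z) (g : Z → X),
      Function.Surjective g ∧ ∀ z z', C * dist (g z) (g z') = dist z z' := by
  let κ : X → lp (fun _ : ℕ => ℝ) ⊤ := fun x => C • kuratowskiEmbedding X x
  have hκ : ∀ x x', dist (κ x) (κ x') = C * dist x x' := fun x x' => by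
    rw [dist_smul₀, (kuratowskiEmbedding.isometry X).dist_eq, Real.norm_of_nonneg hC.le]
  have hcont : Continuous κ := (kuratowskiEmbedding.isometry X).continuous.const_smul C
  have hinj : Function.Injective κ := fun x x' hx => by
    have := hκ x x'
    rw [hx, dist_self, eq_comm, mul_eq_zero] at this
    exact dist_eq_zero.1 (this.resolve_left hC.ne')
  let e := Equiv.ofInjective κ hinj
  refine ⟨Set.range κ, inferInstance, isCompact_iff_compactSpace.1 (isCompact_range hcont),
    inferInstance, e.symm, e.symm.surjective, fun z z' => ?_⟩
  rw [← hκ, Subtype.dist_eq, Equiv.apply_ofInjective_symm hinj,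
    Equiv.apply_ofInjective_symm hinj]

/-- If a family of nonempty compact metric spaces is GH-precompact
(i.e. the corresponding set of isometry classes is totally bounded in
Gromov–Hausdorff space), then there exists a nonempty compact metric space `X`
admitting a `1`-Lipschitz surjection onto each member of the family. -/
theorem stmt4 {ι : Type*} (Y : ι → Type*) [∀ i, MetricSpace (Y i)]
    [∀ i, CompactSpace (Y i)] [∀ i, Nonempty (Y i)]
    (h : TotallyBounded (Set.range fun i => toGHSpace (Y i))) :
    ∃ (X : Type) (_ : MetricSpace X) (_ : CompactSpace X) (_ : Nonempty X),
      ∀ i, ∃ f : X → Y i, Function.Surjective f ∧ LipschitzWith 1 f := by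
  obtain ⟨D, hD⟩ := exists_dist_le_of_totallyBounded h
  choose N hN using fun n : ℕ =>
    exists_nets_of_totallyBounded h (show (0 : ℝ) < (1 / 2) ^ n by positivity)
  choose c hc using hN
  let : MetricSpace (∀ n, Fin (N n + 1)) := PiNat.metricSpace
  have : CompactSpace (∀ n, Fin (N n + 1)) := Pi.compactSpace
  obtain ⟨Z, _, _, _, g, hg, hgd⟩ := exists_compact_rescaling (∀ n, Fin (N n + 1))
    (show 0 < max D 16 by positivity)
  refine ⟨Z, ‹_›, ‹_›, ‹_›, fun i => ?_⟩
  obtain ⟨f, hf, hfd⟩ := exists_surjective_dist_le_piNat (fun n => c n i) (hD i) fun n => hc n i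
  refine ⟨f ∘ g, hf.comp hg, LipschitzWith.of_dist_le_mul fun z z' => ?_⟩
  rw [NNReal.coe_one, one_mul, ← hgd]
  exact hfd _ _
end

section
/- Let (ε_n)_{n∈ℕ} be a sequence of positive real numbers with ε_n → 0. Let (X_n)_{n∈ℕ} and (Y_n)_{n∈ℕ} be sequences of nonempty compact metric spaces converging in the Gromov–Hausdorff distance to nonempty compact metric spaces X and Y, respectively (i.e. d_GH(X_n, X) → 0 and d_GH(Y_n, Y) → 0). If for every n there exists a map f_n : X_n → Y_n with d_{Y_n}(f_n(x), f_n(x')) ≤ d_{X_n}(x, x') + ε_n for all x, x' ∈ X_n and with d_{Y_n}(y, f_n(X_n)) ≤ ε_n for every y ∈ Y_n, then there exists a 1-Lipschitz surjection f : X → Y. -/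
open GromovHausdorff Metric

/-- `f` increases distances by at most `ε`, and every point of the target is within `ε` of a
point in the image of `f`. -/
def IsAlmostShortOnto {X Y : Type*} [MetricSpace X] [MetricSpace Y] (ε : ℝ) (f : X → Y) : Prop :=
  (∀ x x', dist (f x) (f x') ≤ dist x x' + ε) ∧ ∀ y, ∃ x, dist y (f x) ≤ ε

theorem IsAlmostShortOnto.comp {X Y Z : Type*} [MetricSpace X] [MetricSpace Y] [MetricSpace Z]
    {ε δ : ℝ} {g : Y → Z} {f : X → Y} (hg : IsAlmostShortOnto δ g) (hf : IsAlmostShortOnto ε f)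
    (hδ : 0 ≤ δ) : IsAlmostShortOnto (ε + 2 * δ) (g ∘ f) := by
  refine ⟨fun x x' => ?_, fun z => ?_⟩
  · have h₁ := hg.1 (f x) (f x')
    have h₂ := hf.1 x x'
    simp only [Function.comp_apply]
    linarith
  · obtain ⟨y, hy⟩ := hg.2 z
    obtain ⟨x, hx⟩ := hf.2 y
    refine ⟨x, ?_⟩
    have h₁ := hg.1 y (f x)
    have h₂ := dist_triangle z (g y) (g (f x))
    simp only [Function.comp_apply]
    linarith

theorem exists_isAlmostShortOnto_of_hausdorffDist_lt {X Y Z : Type*} [MetricSpace X]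
    [CompactSpace X] [Nonempty X] [MetricSpace Y] [CompactSpace Y] [Nonempty Y] [MetricSpace Z]
    {Φ : X → Z} {Ψ : Y → Z} (hΦ : Isometry Φ) (hΨ : Isometry Ψ) {δ : ℝ}
    (h : hausdorffDist (Set.range Φ) (Set.range Ψ) < δ) :
    ∃ f : X → Y, IsAlmostShortOnto (2 * δ) f := by
  have hfin : hausdorffEDist (Set.range Φ) (Set.range Ψ) ≠ ⊤ :=
    hausdorffEDist_ne_top_of_nonempty_of_bounded (Set.range_nonempty Φ) (Set.range_nonempty Ψ)
      (isCompact_range hΦ.continuous).isBounded (isCompact_range hΨ.continuous).isBounded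
  have hl : ∀ x, ∃ y, dist (Φ x) (Ψ y) < δ := fun x => by
    obtain ⟨_, ⟨y, rfl⟩, hy⟩ := exists_dist_lt_of_hausdorffDist_lt (Set.mem_range_self x) h hfin
    exact ⟨y, hy⟩
  have hr : ∀ y, ∃ x, dist (Φ x) (Ψ y) < δ := fun y => by
    obtain ⟨_, ⟨x, rfl⟩, hx⟩ := exists_dist_lt_of_hausdorffDist_lt' (Set.mem_range_self y) h hfin
    exact ⟨x, hx⟩
  choose f hf using hl
  refine ⟨f, fun x x' => ?_, fun y => ?_⟩
  · rw [← hΨ.dist_eq, ← hΦ.dist_eq x x']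
    have h₁ := dist_triangle4 (Ψ (f x)) (Φ x) (Φ x') (Ψ (f x'))
    rw [dist_comm (Ψ (f x)) (Φ x)] at h₁
    linarith [hf x, hf x']
  · obtain ⟨x, hx⟩ := hr y
    refine ⟨x, ?_⟩
    rw [← hΨ.dist_eq]
    have h₁ := dist_triangle_left (Ψ y) (Ψ (f x)) (Φ x)
    linarith [hf x]

/-- Compact spaces at Gromov–Hausdorff distance less than `δ` admit `2 * δ`-almost short and
onto maps in both directions. -/
theorem exists_isAlmostShortOnto_of_ghDist_lt {X Y : Type*} [MetricSpace X] [CompactSpace X]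
    [Nonempty X] [MetricSpace Y] [CompactSpace Y] [Nonempty Y] {δ : ℝ} (h : ghDist X Y < δ) :
    (∃ f : X → Y, IsAlmostShortOnto (2 * δ) f) ∧ ∃ g : Y → X, IsAlmostShortOnto (2 * δ) g := by
  obtain ⟨Φ, Ψ, hΦ, hΨ, hd⟩ := ghDist_eq_hausdorffDist X Y
  rw [hd] at h
  exact ⟨exists_isAlmostShortOnto_of_hausdorffDist_lt hΦ hΨ h,
    exists_isAlmostShortOnto_of_hausdorffDist_lt hΨ hΦ (hausdorffDist_comm.trans_lt h)⟩

/-- Maps between fixed compact spaces that are almost short and onto, with errors tending to zero,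
yield a `1`-Lipschitz surjection as their limit along an ultrafilter. -/
theorem exists_surjective_lipschitzWith_one_of_isAlmostShortOnto {X Y : Type*} [MetricSpace X]
    [CompactSpace X] [MetricSpace Y] [CompactSpace Y] {η : ℕ → ℝ}
    (hη : Filter.Tendsto η Filter.atTop (nhds 0)) {g : ℕ → X → Y}
    (hg : ∀ n, IsAlmostShortOnto (η n) (g n)) :
    ∃ f : X → Y, Function.Surjective f ∧ LipschitzWith 1 f := by
  let U : Ultrafilter ℕ := Filter.hyperfilter ℕ
  have hηU : Filter.Tendsto η U (nhds 0) := hη.mono_left Nat.hyperfilter_le_atTop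
  have hlim : ∀ x, ∃ y, Filter.Tendsto (fun n => g n x) U (nhds y) := fun x => by
    obtain ⟨y, -, hy⟩ := isCompact_univ.ultrafilter_le_nhds (U.map fun n => g n x) (by simp)
    exact ⟨y, hy⟩
  choose f hf using hlim
  refine ⟨f, fun y => ?_, LipschitzWith.of_dist_le_mul fun x x' => ?_⟩
  · choose u hu using fun n => (hg n).2 y
    obtain ⟨x, -, hx⟩ := isCompact_univ.ultrafilter_le_nhds (U.map u) (by simp)
    have hx : Filter.Tendsto u U (nhds x) := hx
    refine ⟨x, tendsto_nhds_unique (hf x) (tendsto_iff_dist_tendsto_zero.2 ?_)⟩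
    have hbound : Filter.Tendsto (fun n => dist (u n) x + 2 * η n) U (nhds 0) := by
      simpa using (tendsto_iff_dist_tendsto_zero.1 hx).add (hηU.const_mul 2)
    refine squeeze_zero (fun _ => dist_nonneg) (fun n => ?_) hbound
    have h₁ := (hg n).1 (u n) x
    have h₂ := dist_triangle y (g n (u n)) (g n x)
    rw [dist_comm]
    linarith [hu n]
  · have h : dist (f x) (f x') ≤ dist x x' + 0 :=
      le_of_tendsto_of_tendsto' ((hf x).dist (hf x')) (hηU.const_add _) fun n => (hg n).1 x x'
    simpa using h

/-- If `X n → X` and `Y n → Y` in the Gromov–Hausdorff distance, and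
`Y n ≺_{ε n} X n` for every `n` with `ε n → 0`, then there is a `1`-Lipschitz
surjection `X → Y`. -/
theorem stmt6 (ε : ℕ → ℝ) (hεpos : ∀ n, 0 < ε n)
    (hε : Filter.Tendsto ε Filter.atTop (nhds 0))
    (X : ℕ → Type*) [∀ n, MetricSpace (X n)] [∀ n, CompactSpace (X n)]
    [∀ n, Nonempty (X n)]
    (Y : ℕ → Type*) [∀ n, MetricSpace (Y n)] [∀ n, CompactSpace (Y n)]
    [∀ n, Nonempty (Y n)]
    (X' : Type*) [MetricSpace X'] [CompactSpace X'] [Nonempty X']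
    (Y' : Type*) [MetricSpace Y'] [CompactSpace Y'] [Nonempty Y']
    (hX : Filter.Tendsto (fun n => ghDist (X n) X') Filter.atTop (nhds 0))
    (hY : Filter.Tendsto (fun n => ghDist (Y n) Y') Filter.atTop (nhds 0))
    (hf : ∀ n, ∃ f : X n → Y n,
      (∀ x x' : X n, dist (f x) (f x') ≤ dist x x' + ε n) ∧
      ∀ y : Y n, infDist y (Set.range f) ≤ ε n) :
    ∃ f : X' → Y', Function.Surjective f ∧ LipschitzWith 1 f := by
  have hδ : Filter.Tendsto (fun n : ℕ => 1 / ((n : ℝ) + 1)) Filter.atTop (nhds 0) :=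
    tendsto_one_div_add_atTop_nhds_zero_nat
  let a : ℕ → ℝ := fun n => ghDist (X n) X' + 1 / ((n : ℝ) + 1)
  let b : ℕ → ℝ := fun n => ghDist (Y n) Y' + 1 / ((n : ℝ) + 1)
  have ha : Filter.Tendsto a Filter.atTop (nhds 0) := by simpa only [add_zero] using hX.add hδ
  have hb : Filter.Tendsto b Filter.atTop (nhds 0) := by simpa only [add_zero] using hY.add hδ
  have hXa : ∀ n, ghDist (X n) X' < a n := fun n => lt_add_of_pos_right _ (by positivity)
  have hYb : ∀ n, ghDist (Y n) Y' < b n := fun n => lt_add_of_pos_right _ (by positivity)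
  have hb0 : ∀ n, 0 ≤ b n := fun n => by
    obtain ⟨Φ, Ψ, -, -, hd⟩ := ghDist_eq_hausdorffDist (Y n) Y'
    exact (hd ▸ hausdorffDist_nonneg : 0 ≤ ghDist (Y n) Y').trans (hYb n).le
  have hcomp : ∀ n, ∃ g : X' → Y',
      IsAlmostShortOnto (2 * a n + 2 * (2 * ε n) + 2 * (2 * b n)) g := fun n => by
    obtain ⟨h, hh⟩ := (exists_isAlmostShortOnto_of_ghDist_lt (hXa n)).2
    obtain ⟨k, hk⟩ := (exists_isAlmostShortOnto_of_ghDist_lt (hYb n)).1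
    obtain ⟨f, hf₁, hf₂⟩ := hf n
    have hε0 := hεpos n
    have hf' : IsAlmostShortOnto (2 * ε n) f := by
      refine ⟨fun x x' => (hf₁ x x').trans (by linarith), fun y => ?_⟩
      obtain ⟨_, ⟨x, rfl⟩, hx⟩ := (infDist_lt_iff (Set.range_nonempty f)).1
        ((hf₂ y).trans_lt (by linarith : ε n < 2 * ε n))
      exact ⟨x, hx.le⟩
    exact ⟨_, hk.comp (hf'.comp hh (by linarith)) (by linarith [hb0 n])⟩
  choose g hg using hcomp
  refine exists_surjective_lipschitzWith_one_of_isAlmostShortOnto ?_ hg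
  simpa using ((ha.const_mul 2).add ((hε.const_mul 2).const_mul 2)).add
    ((hb.const_mul 2).const_mul 2)
end
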